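/- Let ℋ be a stable ordered-union ultrafilter on FIN and p ∈ ℙ(ℋ). For H ⊆ FIN and m ≤ k < ω, define H[m,k] = {s⁻ : s ∈ H, max(s) = k, min(s) ≥ m}. Then there exists H ∈ ℋ such that for each l ∈ ω, for all but finitely many k in f_max[H] = {max(s) : s ∈ H}: l ≤ k, and for every f ∈ Lev_k(T_p) and every function g : H[l,k] → 2^{𝒫(l)} there exists τ ∈ succ_{T_p}(f) such that τ(x ∪ u) = g(u)(x) for all x ⊆ {0,…,l−1} and all u ∈ H[l,k]. -/

import Mathlib

open Set Filter

abbrev FIN : Type := {s : Finset ℕ // s.Nonempty}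

def maxF (s : FIN) : ℕ := s.1.max' s.2

def minF (s : FIN) : ℕ := s.1.min' s.2

/-- `s <_b t` iff `max s < min t`. -/
def blt (s t : FIN) : Prop := maxF s < minF t

/-- An infinite block sequence, presented as its increasing enumeration. -/
def IsBlockFun (X : ℕ → FIN) : Prop := ∀ i j : ℕ, i < j → blt (X i) (X j)

/-- A block sequence of length `n`. -/
def IsBlockSeqN {n : ℕ} (X : Fin n → FIN) : Prop :=
  ∀ i j : Fin n, i < j → blt (X i) (X j)

/-- `[X]` : all unions of finitely many (at least one) members of `X`. -/
def blocks (X : ℕ → FIN) : Set FIN :=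
  {s | ∃ F : Finset ℕ, F.Nonempty ∧ s.1 = F.sup fun i => (X i).1}

def IsOrderedUnion (H : Ultrafilter FIN) : Prop :=
  ∀ A : Set FIN, A ∈ H →
    ∃ X : ℕ → FIN, IsBlockFun X ∧ blocks X ∈ H ∧ blocks X ⊆ A

def IsStableOU (H : Ultrafilter FIN) : Prop :=
  IsOrderedUnion H ∧
    ∀ Xs : ℕ → ℕ → FIN, (∀ n, IsBlockFun (Xs n) ∧ blocks (Xs n) ∈ H) →
      ∃ Y : ℕ → FIN, IsBlockFun Y ∧ blocks Y ∈ H ∧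
        ∀ n, ∀ᶠ i in atTop, Y i ∈ blocks (Xs n)

def IsSelective (U : Ultrafilter ℕ) : Prop :=
  ∀ f : ℕ → ℕ, ∃ A : Set ℕ, A ∈ U ∧
    ((∀ x ∈ A, ∀ y ∈ A, f x = f y) ∨ Set.InjOn f A)

/-- `I(s) = {k : min s ≤ k ≤ max s}`. -/
def Iset (s : FIN) : Set ℕ := Set.Icc (minF s) (maxF s)

/-- `N(X) = ⋃ i, I(X(i))`. -/
def Nset (X : ℕ → FIN) : Set ℕ := ⋃ i, Iset (X i)

/-- Membership in the class `𝒞₀(ℋ)`. -/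
def MemC0 (H : Ultrafilter FIN) (U : Ultrafilter ℕ) : Prop :=
  IsSelective U ∧
    ∀ X : ℕ → FIN, IsBlockFun X → blocks X ∈ H →
      ∃ Y : ℕ → FIN, IsBlockFun Y ∧ blocks Y ∈ H ∧ blocks Y ⊆ blocks X ∧
        Nset Y ∉ U

def RKle (U V : Ultrafilter ℕ) : Prop := ∃ f : ℕ → ℕ, Ultrafilter.map f V = U

def RKequiv (U V : Ultrafilter ℕ) : Prop := RKle U V ∧ RKle V U

/-- Membership in the class `𝒞₁(ℋ)`. -/
def MemC1 (H : Ultrafilter FIN) (U : Ultrafilter ℕ) : Prop :=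
  IsSelective U ∧
    ∀ V : Ultrafilter ℕ, IsSelective V → ¬ MemC0 H V → ¬ RKequiv U V

def initSeg {α : Type _} (f : ℕ → α) (n : ℕ) : List α := (List.range n).map f

def interleave (a : ℕ → ℕ) (b : ℕ → FIN) (m : ℕ) : ℕ ⊕ FIN :=
  if m % 2 = 0 then Sum.inl (a (m / 2)) else Sum.inr (b (m / 2))

/-- Nodes of the tree `𝕋`: a node of length `l` is a sequence whose `k`-th entry
codes a function `𝒫(k) → 2` (coded as a total function `Finset ℕ → Bool`;
only values on subsets of `{0,…,k−1}` matter). -/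
abbrev Node : Type := List (Finset ℕ → Bool)

/-- `s⁻ = s \ {max s}`. -/
def sm (s : FIN) : Finset ℕ := s.1.erase (maxF s)

/-- `A` is `(k,s)`-big. -/
def IsBig (k : ℕ) (s : FIN) (A : Set (Finset ℕ → Bool)) : Prop :=
  ∀ σ : Finset ℕ → Bool, ∃ τ ∈ A, ∀ u ⊆ Finset.range k, σ u = τ (u ∪ sm s)

def succT (T : Set Node) (f : Node) : Set (Finset ℕ → Bool) := {τ | f ++ [τ] ∈ T}

/-- `H_{p,k}`. -/
def Hset (T : Set Node) (k : ℕ) : Set FIN :=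
  {s | k ≤ maxF s ∧ ∀ f ∈ T, f.length = maxF s → IsBig k s (succT T f)}

/-- `T` is an `ℋ`-condition, i.e. a member of `ℙ(ℋ)`. -/
def IsCond (H : Ultrafilter FIN) (T : Set Node) : Prop :=
  (∀ g ∈ T, ∀ n, g.take n ∈ T) ∧ ([] : Node) ∈ T ∧
    (∀ f ∈ T, ∀ n : ℕ, f.length ≤ n → ∃ g ∈ T, f <+: g ∧ n ≤ g.length) ∧
    ∀ k : ℕ, Hset T k ∈ H

/-- `T⟨f⟩`. -/
def Tsub (T : Set Node) (f : Node) : Set Node := {g ∈ T | f <+: g ∨ g <+: f}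

/-- The constraint linking consecutive moves of Player I in `Γ^Cond(ℋ)`. -/
def StepOK (H : Ultrafilter FIN) (p : Set Node) (s : FIN) (p' : Set Node) : Prop :=
  ∃ q : Node → Set Node,
    (∀ e ∈ p, e.length = maxF s + 1 → IsCond H (q e) ∧ q e ⊆ Tsub p e) ∧
    p' = ⋃ e ∈ {e : Node | e ∈ p ∧ e.length = maxF s + 1}, q e


lemma mem_blocks {X : ℕ → FIN} {s : FIN} : s ∈ blocks X ↔
    ∃ F : Finset ℕ, F.Nonempty ∧ ∀ a, a ∈ s.1 ↔ ∃ i ∈ F, a ∈ (X i).1 := by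
  unfold blocks
  constructor
  · rintro ⟨F, hF, h⟩
    exact ⟨F, hF, fun a => by rw [h, Finset.mem_sup]⟩
  · rintro ⟨F, hF, h⟩
    exact ⟨F, hF, by ext a; rw [h, Finset.mem_sup]⟩

lemma le_maxF {s : FIN} {a : ℕ} (h : a ∈ s.1) : a ≤ maxF s := Finset.le_max' _ _ h
lemma minF_le {s : FIN} {a : ℕ} (h : a ∈ s.1) : minF s ≤ a := Finset.min'_le _ _ h
lemma maxF_mem (s : FIN) : maxF s ∈ s.1 := Finset.max'_mem _ _
lemma minF_mem (s : FIN) : minF s ∈ s.1 := Finset.min'_mem _ _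
lemma minF_le_maxF (s : FIN) : minF s ≤ maxF s := minF_le (maxF_mem s)

lemma blocks_trans {X Y : ℕ → FIN} {s : FIN} (F : Finset ℕ) (hF : F.Nonempty)
    (h : ∀ a, a ∈ s.1 ↔ ∃ i ∈ F, a ∈ (Y i).1) (hY : ∀ i ∈ F, Y i ∈ blocks X) :
    s ∈ blocks X := by
  have : ∀ i, ∃ G : Finset ℕ, i ∈ F → (G.Nonempty ∧ ∀ a, a ∈ (Y i).1 ↔ ∃ j ∈ G, a ∈ (X j).1) := by
    intro i
    by_cases hi : i ∈ F
    · obtain ⟨G, h1, h2⟩ := mem_blocks.1 (hY i hi)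
      exact ⟨G, fun _ => ⟨h1, h2⟩⟩
    · exact ⟨∅, fun h => absurd h hi⟩
  choose G hG using this
  refine mem_blocks.2 ⟨F.biUnion G, ?_, ?_⟩
  · obtain ⟨i, hi⟩ := hF
    obtain ⟨j, hj⟩ := (hG i hi).1
    exact ⟨j, Finset.mem_biUnion.2 ⟨i, hi, hj⟩⟩
  · intro a
    rw [h]
    constructor
    · rintro ⟨i, hi, ha⟩
      obtain ⟨j, hj, ha⟩ := ((hG i hi).2 a).1 ha
      exact ⟨j, Finset.mem_biUnion.2 ⟨i, hi, hj⟩, ha⟩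
    · rintro ⟨j, hj, ha⟩
      obtain ⟨i, hi, hj⟩ := Finset.mem_biUnion.1 hj
      exact ⟨i, hi, ((hG i hi).2 a).2 ⟨j, hj, ha⟩⟩

lemma self_mem_blocks (X : ℕ → FIN) (i : ℕ) : X i ∈ blocks X :=
  mem_blocks.2 ⟨{i}, by simp, by simp⟩

def uF (s t : FIN) : FIN := ⟨s.1 ∪ t.1, s.2.mono Finset.subset_union_left⟩

lemma union_mem_blocks (X : ℕ → FIN) (i j : ℕ) : uF (X i) (X j) ∈ blocks X :=
  mem_blocks.2 ⟨{i, j}, by simp, by simp [uF]⟩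

lemma maxF_strictMono {X : ℕ → FIN} (hX : IsBlockFun X) : StrictMono (fun i => maxF (X i)) := by
  intro i j h
  have := hX i j h
  have h2 := minF_le_maxF (X j)
  unfold blt at this
  show maxF (X i) < maxF (X j)
  omega

open Classical in
noncomputable def shortN (h : ℕ → ℕ) (s : FIN) : ℕ :=
  (s.1.filter (fun i => ∃ j ∈ s.1, i < j ∧ j < h i)).card

open Classical in
lemma shortN_union (h : ℕ → ℕ) (s t : FIN) (hst : blt s t) :
    shortN h (uF s t) = shortN h s + shortN h t + (if minF t < h (maxF s) then 1 else 0) := by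
  have key : ∀ i ∈ s.1, ∀ j ∈ t.1, i < j := fun i hi j hj =>
    lt_of_le_of_lt (le_maxF hi) (lt_of_lt_of_le hst (minF_le hj))
  have e : (uF s t).1.filter (fun i => ∃ j ∈ (uF s t).1, i < j ∧ j < h i) =
      (s.1.filter (fun i => ∃ j ∈ s.1, i < j ∧ j < h i) ∪
        t.1.filter (fun i => ∃ j ∈ t.1, i < j ∧ j < h i)) ∪
        (if minF t < h (maxF s) then {maxF s} else ∅) := by
    ext i
    simp only [uF, Finset.mem_filter, Finset.mem_union]
    constructor
    · rintro ⟨hi | hi, j, hj | hj, hij, hjh⟩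
      · exact Or.inl (Or.inl ⟨hi, j, hj, hij, hjh⟩)
      · rcases (le_maxF hi).eq_or_lt with e | l
        · right
          have := minF_le hj
          rw [if_pos (by rw [← e]; omega)]
          simp [e]
        · exact Or.inl (Or.inl ⟨hi, _, maxF_mem s, l, (key _ (maxF_mem s) _ hj).trans hjh⟩)
      · exact absurd (key _ hj _ hi) (by omega)
      · exact Or.inl (Or.inr ⟨hi, j, hj, hij, hjh⟩)
    · rintro ((⟨hi, j, hj, hh⟩ | ⟨hi, j, hj, hh⟩) | hi)
      · exact ⟨Or.inl hi, j, Or.inl hj, hh⟩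
      · exact ⟨Or.inr hi, j, Or.inr hj, hh⟩
      · split_ifs at hi with hc
        · rw [Finset.mem_singleton] at hi
          subst hi
          exact ⟨Or.inl (maxF_mem s), minF t, Or.inr (minF_mem t), hst, hc⟩
        · simp at hi
  unfold shortN
  rw [e, Finset.card_union_of_disjoint, Finset.card_union_of_disjoint]
  · split_ifs <;> simp
  · rw [Finset.disjoint_left]
    intro a ha hb
    exact lt_irrefl _ (key a (Finset.mem_filter.1 ha).1 a (Finset.mem_filter.1 hb).1)
  · rw [Finset.disjoint_left]
    intro a ha hb
    split_ifs at hb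
    · rw [Finset.mem_singleton] at hb
      subst hb
      rcases Finset.mem_union.1 ha with ha | ha
      · obtain ⟨_, j, hj, hlt, _⟩ := Finset.mem_filter.1 ha
        exact absurd (le_maxF hj) (by omega)
      · exact lt_irrefl _ (key _ (maxF_mem s) _ (Finset.mem_filter.1 ha).1)
    · simp at hb

lemma exists_gap (H : Ultrafilter FIN) (hH : IsOrderedUnion H) (A : Set FIN) (hA : A ∈ H)
    (h : ℕ → ℕ) : ∃ Z : ℕ → FIN, IsBlockFun Z ∧ blocks Z ∈ H ∧ blocks Z ⊆ A ∧
      ∀ i j, i < j → h (maxF (Z i)) ≤ minF (Z j) := by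
  classical
  rcases H.mem_or_compl_mem {s | Even (shortN h s)} with hE | hE
  · obtain ⟨Z, hZ, hZH, hsub⟩ := hH _ (inter_mem hA hE)
    refine ⟨Z, hZ, hZH, fun s hs => (hsub hs).1, fun i j hij => ?_⟩
    by_contra hc
    have h1 : Even (shortN h (Z i)) := (hsub (self_mem_blocks Z i)).2
    have h2 : Even (shortN h (Z j)) := (hsub (self_mem_blocks Z j)).2
    have h3 : Even (shortN h (uF (Z i) (Z j))) := (hsub (union_mem_blocks Z i j)).2
    rw [shortN_union h _ _ (hZ i j hij), if_pos (by omega)] at h3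
    grind
  · obtain ⟨Z, hZ, hZH, hsub⟩ := hH _ (inter_mem hA hE)
    exfalso
    have hm := (maxF_strictMono hZ).id_le (h (maxF (Z 0)))
    have hlt := hZ (h (maxF (Z 0))) (h (maxF (Z 0)) + 1) (by omega)
    have h1 : ¬ Even (shortN h (Z 0)) := (hsub (self_mem_blocks Z 0)).2
    have h2 : ¬ Even (shortN h (Z (h (maxF (Z 0)) + 1))) := (hsub (self_mem_blocks Z _)).2
    have h3 : ¬ Even (shortN h (uF (Z 0) (Z (h (maxF (Z 0)) + 1)))) :=
      (hsub (union_mem_blocks Z _ _)).2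
    unfold blt at hlt
    simp only [id] at hm
    rw [shortN_union h _ _ (hZ 0 _ (by omega)), if_neg (by omega)] at h3
    grind

lemma exists_diag (H : Ultrafilter FIN) (hH : IsStableOU H) (A : ℕ → Set FIN)
    (hA : ∀ k, A k ∈ H) : ∃ Z : ℕ → FIN, IsBlockFun Z ∧ blocks Z ∈ H ∧
      ∀ i j, i < j → Z j ∈ A (maxF (Z i) + 1) := by
  choose X hX hXH hXA using fun k => hH.1 (A k) (hA k)
  obtain ⟨Y, hY, hYH, hal⟩ := hH.2 X (fun n => ⟨hX n, hXH n⟩)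
  choose N hN using fun n => eventually_atTop.1 (hal n)
  obtain ⟨Z, hZ, hZH, hZY, hgap⟩ := exists_gap H hH.1 _ hYH (fun m => maxF (Y (N (m+1))))
  refine ⟨Z, hZ, hZH, fun i j hij => ?_⟩
  apply hXA
  obtain ⟨F, hF, hmem⟩ := mem_blocks.1 (hZY (self_mem_blocks Z j))
  refine blocks_trans F hF hmem fun a ha => ?_
  apply hN
  have h1 := minF_le ((hmem _).2 ⟨a, ha, maxF_mem (Y a)⟩)
  have h2 := (hgap i j hij).trans h1
  exact (maxF_strictMono hY).le_iff_le.1 h2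

lemma block_index {Z : ℕ → FIN} (hZ : IsBlockFun Z) {s : FIN} (hs : s ∈ blocks Z) :
    ∃ n, maxF s = maxF (Z n) := by
  obtain ⟨F, hF, h⟩ := mem_blocks.1 hs
  obtain ⟨i, hi, ha⟩ := (h _).1 (maxF_mem s)
  exact ⟨i, le_antisymm (le_maxF ha) (le_maxF ((h _).2 ⟨i, hi, maxF_mem _⟩))⟩

lemma block_decomp {Z : ℕ → FIN} (hZ : IsBlockFun Z) {s : FIN} (hs : s ∈ blocks Z) {n : ℕ}
    (hn : maxF s = maxF (Z (n+1))) :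
    sm s = (s.1 ∩ Finset.range (maxF (Z n) + 1)) ∪ sm (Z (n+1)) := by
  have hm := maxF_strictMono hZ
  have hlt : maxF (Z n) < minF (Z (n+1)) := hZ n (n+1) (by omega)
  have hle := minF_le_maxF (Z (n+1))
  obtain ⟨F, hF, h⟩ := mem_blocks.1 hs
  have hnF : n + 1 ∈ F := by
    obtain ⟨i, hi, ha⟩ := (h _).1 (maxF_mem s)
    have e : maxF s = maxF (Z i) :=
      le_antisymm (le_maxF ha) (le_maxF ((h _).2 ⟨i, hi, maxF_mem _⟩))
    have : i = n + 1 := hm.injective (e.symm.trans hn)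
    rwa [← this]
  ext a
  simp only [sm, Finset.mem_erase, Finset.mem_union, Finset.mem_inter, Finset.mem_range, hn]
  constructor
  · rintro ⟨hne, ha⟩
    obtain ⟨i, hi, hai⟩ := (h a).1 ha
    have h1 : maxF (Z i) ≤ maxF (Z (n+1)) := hn ▸ le_maxF ((h _).2 ⟨i, hi, maxF_mem _⟩)
    have h2 : i ≤ n + 1 := hm.le_iff_le.1 h1
    rcases h2.eq_or_lt with rfl | h2
    · exact Or.inr ⟨hne, hai⟩
    · have h3 : maxF (Z i) ≤ maxF (Z n) := hm.monotone (Nat.lt_succ_iff.1 h2)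
      have := le_maxF hai
      exact Or.inl ⟨ha, by omega⟩
  · rintro (⟨ha, h1⟩ | ⟨hne, ha⟩)
    · exact ⟨by omega, ha⟩
    · exact ⟨hne, (h a).2 ⟨_, hnF, ha⟩⟩

/-- for every `p ∈ ℙ(ℋ)` there is `B ∈ ℋ` such that for each `l`,
for all but finitely many `k ∈ f_max[B]`, `l ≤ k` and property `(∗_{l,k})`
holds: for every `f ∈ Lev_k(T_p)` and every `g : B[l,k] → 2^{𝒫(l)}` there is
`τ ∈ succ_{T_p}(f)` with `τ(x ∪ u) = g(u)(x)` for all `x ⊆ {0,…,l−1}` and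
`u ∈ B[l,k] = {s⁻ : s ∈ B, max s = k, min s ≥ l}`. -/
theorem stmt8 (H : Ultrafilter FIN) (hH : IsStableOU H)
    (T : Set Node) (hT : IsCond H T) :
    ∃ B : Set FIN, B ∈ H ∧
      ∀ l : ℕ, ∃ k0 : ℕ, ∀ k : ℕ, (∃ s ∈ B, maxF s = k) → k0 ≤ k →
        l ≤ k ∧
        ∀ f ∈ T, f.length = k →
          ∀ g : Finset ℕ → (Finset ℕ → Bool),
            ∃ τ, τ ∈ succT T f ∧
              ∀ x ⊆ Finset.range l, ∀ s ∈ B, maxF s = k → l ≤ minF s →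
                τ (x ∪ sm s) = g (sm s) x := by
  obtain ⟨Z, hZ, hZH, hd⟩ := exists_diag H hH (Hset T) hT.2.2.2
  have hm := maxF_strictMono hZ
  refine ⟨blocks Z, hZH, fun l => ⟨maxF (Z l) + 1, ?_⟩⟩
  rintro k ⟨s0, hs0, rfl⟩ hk
  have hl : l ≤ maxF (Z l) := hm.id_le l
  refine ⟨by omega, ?_⟩
  obtain ⟨n', hn'⟩ := block_index hZ hs0
  rw [hn'] at hk ⊢
  have hln : l < n' := hm.lt_iff_lt.1 hk
  obtain ⟨n, rfl⟩ : ∃ n, n' = n + 1 := ⟨n' - 1, by omega⟩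
  have hl2 : maxF (Z l) ≤ maxF (Z n) := hm.monotone (by omega)
  have hlt : maxF (Z n) < minF (Z (n+1)) := hZ n (n+1) (by omega)
  intro f hf hfl g
  obtain ⟨τ, hτ, hτ2⟩ := (hd n (n+1) (by omega)).2 f hf hfl
    (fun u => g ((u \ Finset.range l) ∪ sm (Z (n+1))) (u ∩ Finset.range l))
  refine ⟨τ, hτ, fun x hx s hs hsk hls => ?_⟩
  have e := block_decomp hZ hs hsk
  have hxl : ∀ a ∈ x, a < l := fun a ha => Finset.mem_range.1 (hx ha)
  have hsl : ∀ a ∈ s.1, l ≤ a := fun a ha => hls.trans (minF_le ha)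
  have := hτ2 (x ∪ (s.1 ∩ Finset.range (maxF (Z n) + 1))) (by
    intro a ha
    simp only [Finset.mem_union, Finset.mem_inter, Finset.mem_range] at ha ⊢
    rcases ha with ha | ha
    · have := hxl a ha; omega
    · exact ha.2)
  have e1 : (x ∪ (s.1 ∩ Finset.range (maxF (Z n) + 1))) \ Finset.range l =
      s.1 ∩ Finset.range (maxF (Z n) + 1) := by
    ext a
    have := hxl a
    have := hsl a
    simp only [Finset.mem_union, Finset.mem_inter, Finset.mem_range, Finset.mem_sdiff]
    grind
  have e2 : (x ∪ (s.1 ∩ Finset.range (maxF (Z n) + 1))) ∩ Finset.range l = x := by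
    ext a
    have := hxl a
    have := hsl a
    simp only [Finset.mem_union, Finset.mem_inter, Finset.mem_range]
    grind
  simp only [e1, e2, ← e, Finset.union_assoc] at this
  exact this.symm
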